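/- The abelian Lie algebra 𝔤₆ = {T(0,b) | b ∈ ℝi ⊕ ℝj} is a Berger algebra: the endomorphisms R(u, v), for R an algebraic curvature tensor of type 𝔤₆ and u, v ∈ V, span 𝔤₆ over ℝ. -/

import Mathlib

open Quaternion

noncomputable section

/-- `V = ℍ × ℍ`, the pseudo-quaternionic-Hermitian space `ℍ^{1,1}` in an isotropic basis
`p = (1,0)`, `q = (0,1)`. -/
abbrev V : Type := ℍ[ℝ] × ℍ[ℝ]

/-- The neutral-signature metric `η((x,y),(x',y')) = Re(x conj(y') + y conj(x'))`. -/
def η (u v : V) : ℝ := (u.1 * star v.2 + u.2 * star v.1).re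

/-- The endomorphism of `ℍ^{1,1}` with matrix `[[a, b], [0, -conj a]]` in the isotropic
basis `(p, q)`: `T(a,b)(x,y) = (x a + y b, − y conj(a))`. -/
def T (a b : ℍ[ℝ]) : Module.End ℝ V where
  toFun u := (u.1 * a + u.2 * b, -(u.2 * star a))
  map_add' u v := by
    simp only [Prod.fst_add, Prod.snd_add, add_mul, Prod.mk_add_mk, Prod.mk.injEq]
    constructor <;> abel
  map_smul' r u := by
    simp only [Prod.smul_fst, Prod.smul_snd, RingHom.id_apply, Prod.smul_mk,
      smul_mul_assoc, smul_add, smul_neg]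

/-- `R` is an algebraic curvature tensor of type `g`: a bilinear alternating map
`V × V → End_ℝ(V)` with values in `g` satisfying the first Bianchi identity. -/
def IsCurv (g : Set (Module.End ℝ V)) (R : V →ₗ[ℝ] V →ₗ[ℝ] Module.End ℝ V) : Prop :=
  (∀ u v : V, R u v = - R v u) ∧ (∀ u v : V, R u v ∈ g) ∧
  (∀ u v w : V, R u v w + R v w u + R w u v = 0)

/-- The abelian Lie algebra `𝔤₆ = {T(0,b) | b ∈ ℝi ⊕ ℝj}`. -/
def g : Set (Module.End ℝ V) :=
  {f | ∃ b : ℍ[ℝ], b.re = 0 ∧ b.imK = 0 ∧ f = T 0 b}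

/-- The quaternion `s i + t j`. -/
def imIJ (s t : ℝ) : ℍ[ℝ] := ⟨0, s, t, 0⟩

@[simp] lemma imIJ_re (s t : ℝ) : (imIJ s t).re = 0 := rfl

@[simp] lemma imIJ_imI (s t : ℝ) : (imIJ s t).imI = s := rfl

@[simp] lemma imIJ_imJ (s t : ℝ) : (imIJ s t).imJ = t := rfl

@[simp] lemma imIJ_imK (s t : ℝ) : (imIJ s t).imK = 0 := rfl

/-- The alternating bilinear map `(y, z) ↦ ω_i(y,z) i - ω_j(y,z) j` on `ℍ`, where `ω_a` is
the form `Re(y a conj(z))` in `y` and `z`. -/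
def weylForm : ℍ[ℝ] →ₗ[ℝ] ℍ[ℝ] →ₗ[ℝ] ℍ[ℝ] :=
  LinearMap.mk₂ ℝ
    (fun y z => imIJ (y * imIJ 1 0 * star z).re (-(y * imIJ 0 1 * star z).re))
    (fun y y' z => by ext <;> simp <;> ring)
    (fun c y z => by ext <;> simp; ring)
    (fun y z z' => by ext <;> simp <;> ring)
    (fun c y z => by ext <;> simp; ring)

lemma weylForm_apply (y z : ℍ[ℝ]) :
    weylForm y z = imIJ (y * imIJ 1 0 * star z).re (-(y * imIJ 0 1 * star z).re) :=
  rfl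

lemma weylForm_antisymm (y z : ℍ[ℝ]) : weylForm y z = -weylForm z y := by
  ext <;> simp [weylForm_apply] <;> ring

lemma weylForm_bianchi (x y z : ℍ[ℝ]) :
    z * weylForm x y + x * weylForm y z + y * weylForm z x = 0 := by
  ext <;> simp [weylForm_apply] <;> ring

lemma T_zero_apply (b : ℍ[ℝ]) (u : V) : T 0 b u = (u.2 * b, 0) := by
  simp [T]

/-- The linear map `b ↦ T(0,b)`. -/
def TZero : ℍ[ℝ] →ₗ[ℝ] Module.End ℝ V where
  toFun b := T 0 b
  map_add' b c := LinearMap.ext fun u => by simp [T_zero_apply, mul_add]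
  map_smul' r b := LinearMap.ext fun u => by simp [T_zero_apply]

/-- The curvature tensor `R(u,v) = T(0, weylForm y z)`, where `y`, `z` are the second
components of `u`, `v`. -/
def weylTensor : V →ₗ[ℝ] V →ₗ[ℝ] Module.End ℝ V :=
  (weylForm.compl₁₂ (LinearMap.snd ℝ ℍ[ℝ] ℍ[ℝ]) (LinearMap.snd ℝ ℍ[ℝ] ℍ[ℝ])).compr₂ TZero

lemma weylTensor_apply (u v : V) : weylTensor u v = T 0 (weylForm u.2 v.2) :=
  rfl

lemma isCurv_weylTensor : IsCurv g weylTensor := by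
  refine ⟨fun u v => ?_, fun u v => ⟨_, imIJ_re _ _, imIJ_imK _ _, weylTensor_apply u v⟩,
    fun u v w => ?_⟩
  · rw [weylTensor_apply, weylForm_antisymm]
    exact map_neg TZero _
  · simp only [weylTensor_apply, T_zero_apply, Prod.mk_add_mk, weylForm_bianchi, add_zero,
      Prod.mk_zero_zero]

lemma T_zero_eq_weylTensor {b : ℍ[ℝ]} (hre : b.re = 0) (hk : b.imK = 0) :
    T 0 b = weylTensor (0, 1) (0, imIJ b.imI (-b.imJ)) := by
  rw [weylTensor_apply]
  congr 1
  ext <;> simp [weylForm_apply, hre, hk]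

/-- this Lie algebra is a Berger algebra: the endomorphisms `R u v`, for
`R` an algebraic curvature tensor of type the algebra and `u, v ∈ V`, span it over ℝ. -/
theorem g6_is_berger_algebra :
    Submodule.span ℝ {f : Module.End ℝ V |
        ∃ R : V →ₗ[ℝ] V →ₗ[ℝ] Module.End ℝ V, IsCurv g R ∧ ∃ u v : V, f = R u v}
      = Submodule.span ℝ g := by
  congr 1
  ext f
  constructor
  · rintro ⟨R, hR, u, v, rfl⟩
    exact hR.2.1 u v
  · rintro ⟨b, hre, hk, rfl⟩
    exact ⟨weylTensor, isCurv_weylTensor, _, _, T_zero_eq_weylTensor hre hk⟩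

end
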